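/- Let < be a linear order on the variables and C a finite set of nonempty standard-form clauses that is <-primal non-conflicting. Then C forms an island: for any two states that each satisfy all clauses in C, there is a finite sequence of states, each satisfying all clauses in C, connecting them, in which consecutive states differ in the value of exactly one variable. -/

import Mathlib

/-- A state assigns a Boolean value to every variable. -/
abbrev State (V : Type*) := V → Bool

/-- A state satisfies a clause (a finite set of literals) if at least one
of its literals is true in the state. -/
def Sat {V : Type*} (s : State V) (c : Finset (V × Bool)) : Prop :=
  ∃ l ∈ c, s l.1 = l.2

/-- A clause is in standard form if no variable occurs in it with both polarities. -/
def StdForm {V : Type*} (c : Finset (V × Bool)) : Prop :=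
  ¬ ∃ x : V, (x, true) ∈ c ∧ (x, false) ∈ c

/-- `l` is the `<`-primal literal of clause `c`: it belongs to `c` and its variable is
least (w.r.t. the order) among the variables occurring in `c`. -/
def PrimalLit {V : Type*} [LinearOrder V] (c : Finset (V × Bool)) (l : V × Bool) : Prop :=
  l ∈ c ∧ ∀ l' ∈ c, l.1 ≤ l'.1

/-- The `<`-primal literal set of a set of clauses. -/
def PLit {V : Type*} [LinearOrder V] (C : Set (Finset (V × Bool))) : Set (V × Bool) :=
  {l | ∃ c ∈ C, PrimalLit c l}

/-- `C` is `<`-primal non-conflicting if no variable occurs with both polarities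
in the `<`-primal literal set of `C`. -/
def PrimalNonConflicting {V : Type*} [LinearOrder V] (C : Set (Finset (V × Bool))) : Prop :=
  ¬ ∃ x : V, (x, true) ∈ PLit C ∧ (x, false) ∈ PLit C

/-- Two states are neighbours if they differ in the value of exactly one variable. -/
def Neighbour {V : Type*} (s s' : State V) : Prop :=
  ∃! x : V, s x ≠ s' x

/-- A set `C` of clauses is an island if any two states satisfying every clause of `C`
are connected by a finite sequence of states, each satisfying every clause of `C`,
in which consecutive states are neighbours. -/
def IsIsland {V : Type*} (C : Set (Finset (V × Bool))) : Prop :=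
  ∀ s₀ sN : State V, (∀ c ∈ C, Sat s₀ c) → (∀ c ∈ C, Sat sN c) →
    ∃ (n : ℕ) (p : Fin (n + 1) → State V),
      p 0 = s₀ ∧ p (Fin.last n) = sN ∧
      (∀ i, ∀ c ∈ C, Sat (p i) c) ∧
      ∀ i : Fin n, Neighbour (p i.castSucc) (p i.succ)

/-- One step inside the solution set of `C`: both states satisfy every clause of `C` and they
are neighbours. -/
def SolutionStep {V : Type*} (C : Set (Finset (V × Bool))) (s s' : State V) : Prop :=
  (∀ c ∈ C, Sat s c) ∧ (∀ c ∈ C, Sat s' c) ∧ Neighbour s s'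

theorem Neighbour.symm {V : Type*} {s s' : State V} (h : Neighbour s s') : Neighbour s' s := by
  simpa only [Neighbour, ne_comm] using h

instance SolutionStep.stdSymm {V : Type*} (C : Set (Finset (V × Bool))) :
    Std.Symm (SolutionStep C) :=
  ⟨fun _ _ h => ⟨h.2.1, h.1, h.2.2.symm⟩⟩

theorem exists_path_of_reflTransGen {V : Type*} {C : Set (Finset (V × Bool))} {s t : State V}
    (ht : ∀ c ∈ C, Sat t c) (h : Relation.ReflTransGen (SolutionStep C) s t) :
    ∃ (n : ℕ) (p : Fin (n + 1) → State V),
      p 0 = s ∧ p (Fin.last n) = t ∧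
      (∀ i, ∀ c ∈ C, Sat (p i) c) ∧
      ∀ i : Fin n, Neighbour (p i.castSucc) (p i.succ) := by
  induction h using Relation.ReflTransGen.head_induction_on with
  | refl => exact ⟨0, fun _ => t, rfl, rfl, fun _ => ht, fun i => i.elim0⟩
  | @head a b hab _ ih =>
    obtain ⟨n, p, hp0, hpn, hsat, hnb⟩ := ih
    refine ⟨n + 1, Fin.cons a p, Fin.cons_zero _ _, ?_, ?_, ?_⟩
    · rw [← Fin.succ_last, Fin.cons_succ, hpn]
    · intro i
      refine Fin.cases ?_ (fun j => ?_) i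
      · simpa using hab.1
      · simpa using hsat j
    · intro i
      refine Fin.cases ?_ (fun j => ?_) i
      · simpa [hp0] using hab.2.2
      · simpa only [Fin.cons_succ, ← Fin.succ_castSucc] using hnb j

theorem exists_primalLit {V : Type*} [LinearOrder V] {c : Finset (V × Bool)}
    (hc : c.Nonempty) : ∃ l, PrimalLit c l :=
  c.exists_min_image Prod.fst hc

/-- If `t` makes all primal literals true, then overwriting a solution by `t` on a lower set
of variables gives a solution. -/
theorem sat_piecewise_of_isLowerSet {V : Type*} [LinearOrder V] {C : Set (Finset (V × Bool))}
    (hne : ∀ c ∈ C, c.Nonempty) {s t : State V} (hs : ∀ c ∈ C, Sat s c)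
    (ht : ∀ l ∈ PLit C, t l.1 = l.2) {L : Finset V} (hL : IsLowerSet (L : Set V)) :
    ∀ c ∈ C, Sat (L.piecewise t s) c := by
  intro c hc
  obtain ⟨l, hl⟩ := exists_primalLit (hne c hc)
  by_cases hlL : l.1 ∈ L
  · exact ⟨l, hl.1, by rw [Finset.piecewise_eq_of_mem _ _ _ hlL]; exact ht l ⟨c, hc, hl⟩⟩
  · obtain ⟨m, hm, hsm⟩ := hs c hc
    have hmL : m.1 ∉ L := fun h => hlL (hL (hl.2 m hm) h)
    exact ⟨m, hm, by rw [Finset.piecewise_eq_of_notMem _ _ _ hmL]; exact hsm⟩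

theorem neighbour_update {V : Type*} [DecidableEq V] (s : State V) {a : V} {b : Bool}
    (h : s a ≠ b) : Neighbour s (Function.update s a b) := by
  refine ⟨a, by simpa using h, fun y hy => ?_⟩
  by_contra hya
  exact hy (Function.update_of_ne hya _ _).symm

theorem reflTransGen_piecewise {V : Type*} [LinearOrder V] {C : Set (Finset (V × Bool))}
    (hne : ∀ c ∈ C, c.Nonempty) {s t : State V} (hs : ∀ c ∈ C, Sat s c)
    (ht : ∀ l ∈ PLit C, t l.1 = l.2) (L : Finset V) (hL : IsLowerSet (L : Set V)) :
    Relation.ReflTransGen (SolutionStep C) s (L.piecewise t s) := by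
  induction L using Finset.induction_on_max with
  | empty => rw [Finset.piecewise_empty]
  | insert a L ha ih =>
    have hL' : IsLowerSet (L : Set V) := by
      intro x y hyx hx
      have hxa : x < a := ha x hx
      have hy : y ∈ insert a L := hL hyx (Finset.mem_insert_of_mem hx)
      exact Finset.mem_of_mem_insert_of_ne hy (hyx.trans_lt hxa).ne
    have hsat := sat_piecewise_of_isLowerSet hne hs ht hL
    refine (ih hL').trans ?_
    rw [Finset.piecewise_insert] at hsat ⊢
    by_cases h : L.piecewise t s a = t a
    · rw [← h, Function.update_eq_self]
    · exact .single ⟨sat_piecewise_of_isLowerSet hne hs ht hL', hsat, neighbour_update _ h⟩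

/-- A `<`-primal non-conflicting finite set of nonempty standard-form clauses
forms an island. -/
theorem primalNonConflicting_isIsland {V : Type*} [LinearOrder V] [Fintype V]
    (C : Finset (Finset (V × Bool)))
    (hne : ∀ c ∈ C, Finset.Nonempty c) (hstd : ∀ c ∈ C, StdForm c)
    (hpnc : PrimalNonConflicting (↑C : Set (Finset (V × Bool)))) :
    IsIsland (↑C : Set (Finset (V × Bool))) := by
  classical
  intro s₀ sN h₀ hN
  let t : State V := fun x => decide ((x, true) ∈ PLit (↑C : Set (Finset (V × Bool))))
  have ht : ∀ l ∈ PLit (↑C : Set (Finset (V × Bool))), t l.1 = l.2 := by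
    rintro ⟨x, b⟩ hl
    cases b with
    | true => exact decide_eq_true hl
    | false => exact decide_eq_false fun h => hpnc ⟨x, h, hl⟩
  have reach : ∀ s : State V, (∀ c ∈ C, Sat s c) →
      Relation.ReflTransGen (SolutionStep (↑C : Set (Finset (V × Bool)))) s t := by
    intro s hs
    simpa using reflTransGen_piecewise hne hs ht Finset.univ (by simpa using isLowerSet_univ)
  exact exists_path_of_reflTransGen hN
    ((reach s₀ h₀).trans
      (Std.Symm.symm _ _ (reach sN hN)))
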